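/- Let C ⊆ F2^72 be a binary self-dual doubly-even linear code with minimum nonzero weight 16, and let g ∈ S_72 be the permutation that cyclically permutes each of the fourteen blocks {5k+1,…,5k+5} for k = 0,…,13 (a product of fourteen disjoint 5-cycles) and fixes the coordinates 71 and 72. Assume g ∈ Aut(C). Define D0 := {a ∈ F2^14 : r5(a) ∈ C}, where r5(a) ∈ F2^72 is the vector whose entry at position 5k+j (k = 0,…,13, j = 1,…,5) equals a_{k+1} and whose entries at positions 71 and 72 are 0. Then there exist a permutation π ∈ S_14 and a self-dual binary code A ⊆ F2^14 with minimum nonzero weight 4 such that {a∘π : a ∈ D0} = {a ∈ A : 4 divides wt(a)}, i.e., D0 is permutation-equivalent to the maximal doubly-even subcode of a self-dual code of length 14 and minimum distance 4. -/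

import Mathlib

/-- The Hamming weight of a binary vector: the number of nonzero coordinates. -/
def wt {n : ℕ} (c : Fin n → ZMod 2) : ℕ := (Finset.univ.filter fun i => c i ≠ 0).card

/-- The standard inner product on `F2^n`. -/
def inner2 {n : ℕ} (v w : Fin n → ZMod 2) : ZMod 2 := ∑ i, v i * w i

/-- A binary code is self-dual if it equals its dual with respect to the
standard inner product. -/
def IsSelfDual {n : ℕ} (C : Submodule (ZMod 2) (Fin n → ZMod 2)) : Prop :=
  (C : Set (Fin n → ZMod 2)) = {v | ∀ c ∈ C, inner2 v c = 0}

/-- A binary code is doubly even if every codeword has weight divisible by 4. -/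
def IsDoublyEven {n : ℕ} (C : Submodule (ZMod 2) (Fin n → ZMod 2)) : Prop :=
  ∀ c ∈ C, 4 ∣ wt c

/-- The permutation of `{1,…,72}` that cyclically permutes each of the fourteen
blocks `{5k+1,…,5k+5}` (`k = 0,…,13`) and fixes the coordinates 71 and 72,
written 0-indexed on `Fin 72`: a product of fourteen disjoint 5-cycles. -/
def g5 : Equiv.Perm (Fin 72) where
  toFun i := if h : i.val < 70 then
      ⟨5 * (i.val / 5) + ((i.val % 5 + 1) % 5), by omega⟩ else i
  invFun i := if h : i.val < 70 then
      ⟨5 * (i.val / 5) + ((i.val % 5 + 4) % 5), by omega⟩ else i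
  left_inv := by decide
  right_inv := by decide

/-- The 5-fold repetition map `F2^14 → F2^72`: the entry of `r5 a` at position
`5k+j` (`k = 0,…,13`, `j = 1,…,5`) equals `a_{k+1}`, and the entries at the two
fixed positions 71 and 72 are `0`. -/
def r5 : (Fin 14 → ZMod 2) →ₗ[ZMod 2] (Fin 72 → ZMod 2) where
  toFun a := fun i => if h : i.val < 70 then a ⟨i.val / 5, by omega⟩ else 0
  map_add' := by intro a b; funext i; by_cases h : i.val < 70 <;> simp [h]
  map_smul' := by intro m a; funext i; by_cases h : i.val < 70 <;> simp [h]

def ix (k : Fin 14) (j : Fin 5) : Fin 72 := ⟨5 * k.val + j.val, by omega⟩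

def ee : Fin 72 → ZMod 2 := fun i => if i.val < 70 then 0 else 1

lemma sum72 {M : Type*} [AddCommMonoid M] (f : Fin 72 → M) :
    ∑ i, f i = (∑ k, ∑ j, f (ix k j)) + f 70 + f 71 := by
  rw [Fin.sum_univ_castSucc, Fin.sum_univ_castSucc]
  congr 2
  rw [← Fintype.sum_prod_type', ← (finProdFinEquiv (m := 14) (n := 5)).sum_comp]
  refine Finset.sum_congr rfl fun x _ => ?_
  congr 1
  ext
  simp [ix, finProdFinEquiv, add_comm]

lemma g5_ix (k : Fin 14) (j : Fin 5) : g5 (ix k j) = ix k (j + 1) := by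
  revert k j; decide

lemma g5_70 : g5 70 = 70 := by decide
lemma g5_71 : g5 71 = 71 := by decide

lemma cases72 (i : Fin 72) : (∃ k j, i = ix k j) ∨ i = 70 ∨ i = 71 := by
  by_cases h : i.val < 70
  · left
    refine ⟨⟨i.val / 5, by omega⟩, ⟨i.val % 5, by omega⟩, ?_⟩
    ext; simp only [ix]; omega
  · right
    have := i.2
    have : i.val = 70 ∨ i.val = 71 := by omega
    rcases this with h | h
    · left; ext; exact h
    · right; ext; exact h

lemma r5_ix (a : Fin 14 → ZMod 2) (k : Fin 14) (j : Fin 5) : r5 a (ix k j) = a k := by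
  have h1 : (ix k j).val < 70 := by simp only [ix]; omega
  have h2 : (ix k j).val / 5 = k.val := by simp only [ix]; omega
  simp only [r5, LinearMap.coe_mk, AddHom.coe_mk, h1, dif_pos]
  congr 1
  ext; exact h2

lemma r5_70 (a : Fin 14 → ZMod 2) : r5 a 70 = 0 := by simp [r5]
lemma r5_71 (a : Fin 14 → ZMod 2) : r5 a 71 = 0 := by simp [r5]

lemma ee_ix (k : Fin 14) (j : Fin 5) : ee (ix k j) = 0 := by
  have h1 : (ix k j).val < 70 := by simp only [ix]; omega
  simp [ee, h1]
lemma ee_70 : ee 70 = 1 := by simp [ee]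
lemma ee_71 : ee 71 = 1 := by simp [ee]

lemma zmod2_cases (t : ZMod 2) : t = 0 ∨ t = 1 := by revert t; decide

lemma wt_eq {n : ℕ} (c : Fin n → ZMod 2) : wt c = ∑ i, if c i ≠ 0 then 1 else 0 := by
  simp [wt, Finset.card_filter]

lemma wt_r5 (a : Fin 14 → ZMod 2) : wt (r5 a) = 5 * wt a := by
  rw [wt_eq, wt_eq, sum72]
  simp only [r5_ix, r5_70, r5_71, Finset.sum_const, Finset.mul_sum]
  simp

lemma wt_r5e (a : Fin 14 → ZMod 2) : wt (r5 a + ee) = 5 * wt a + 2 := by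
  rw [wt_eq, wt_eq, sum72]
  simp only [Pi.add_apply, r5_ix, r5_70, r5_71, ee_ix, ee_70, ee_71, Finset.sum_const,
    Finset.mul_sum]
  simp

/-- block sums -/
def bs (c : Fin 72 → ZMod 2) : Fin 14 → ZMod 2 := fun k => ∑ j, c (ix k j)

lemma inner_r5 (v : Fin 14 → ZMod 2) (c : Fin 72 → ZMod 2) :
    inner2 (r5 v) c = inner2 v (bs c) := by
  unfold inner2 bs
  rw [sum72]
  simp only [r5_ix, r5_70, r5_71, Finset.mul_sum]
  simp

lemma inner_ee (c : Fin 72 → ZMod 2) : inner2 ee c = c 70 + c 71 := by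
  unfold inner2
  rw [sum72]
  simp [ee_ix, ee_70, ee_71]

lemma five (x : ZMod 2) : x + x + x + x + x = x := by revert x; decide

lemma bs_r5 (a : Fin 14 → ZMod 2) (t : ZMod 2) : bs (r5 a + t • ee) = a := by
  funext k
  simp only [bs, Pi.add_apply, Pi.smul_apply, r5_ix, ee_ix, Fin.sum_univ_five, smul_zero, add_zero]
  exact five _

lemma inner2_add_left {n : ℕ} (u v w : Fin n → ZMod 2) :
    inner2 (u + v) w = inner2 u w + inner2 v w := by
  simp [inner2, add_mul, Finset.sum_add_distrib]
lemma inner2_add_right {n : ℕ} (u v w : Fin n → ZMod 2) :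
    inner2 u (v + w) = inner2 u v + inner2 u w := by
  simp [inner2, mul_add, Finset.sum_add_distrib]
lemma inner_smul_left' {n : ℕ} (t : ZMod 2) (v w : Fin n → ZMod 2) :
    inner2 (t • v) w = t * inner2 v w := by
  simp [inner2, mul_assoc, Finset.mul_sum]

lemma symm_mem (C : Submodule (ZMod 2) (Fin 72 → ZMod 2))
    (hg : (fun c => c ∘ ⇑g5) '' (C : Set (Fin 72 → ZMod 2)) = C)
    (c : Fin 72 → ZMod 2) (hc : c ∈ C) (h : c 70 = c 71) :
    r5 (bs c) + (c 70) • ee ∈ C := by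
  have key : ∀ d ∈ C, d ∘ ⇑g5 ∈ C := fun d hd => by
    have : d ∘ ⇑g5 ∈ (fun c => c ∘ ⇑g5) '' (C : Set (Fin 72 → ZMod 2)) := ⟨d, hd, rfl⟩
    rwa [hg] at this
  have h1 := key _ hc
  have h2 := key _ h1
  have h3 := key _ h2
  have h4 := key _ h3
  have hs := C.add_mem (C.add_mem (C.add_mem (C.add_mem hc h1) h2) h3) h4
  convert hs using 1
  funext i
  rcases cases72 i with ⟨k, j, rfl⟩ | rfl | rfl
  · simp only [Pi.add_apply, Pi.smul_apply, Function.comp_apply, r5_ix, ee_ix, g5_ix, bs,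
      Fin.sum_univ_five, smul_zero, add_zero]
    fin_cases j <;> simp <;> ring
  · simp only [Pi.add_apply, Pi.smul_apply, Function.comp_apply, r5_70, ee_70, g5_70, five]
    simp
  · simp only [Pi.add_apply, Pi.smul_apply, Function.comp_apply, r5_71, ee_71, g5_71, five]
    simp [h]

/-- The self-dual code of length 14. -/
def AA (C : Submodule (ZMod 2) (Fin 72 → ZMod 2)) : Submodule (ZMod 2) (Fin 14 → ZMod 2) where
  carrier := {a | ∃ t : ZMod 2, r5 a + t • ee ∈ C}
  zero_mem' := ⟨0, by simp⟩
  add_mem' := by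
    rintro a b ⟨s, hs⟩ ⟨t, ht⟩
    refine ⟨s + t, ?_⟩
    have := C.add_mem hs ht
    convert this using 1
    rw [map_add, add_smul]; abel
  smul_mem' := by
    rintro m a ⟨s, hs⟩
    refine ⟨m * s, ?_⟩
    have := C.smul_mem m hs
    convert this using 1
    rw [map_smul, smul_add, mul_smul]

lemma mem_AA (C : Submodule (ZMod 2) (Fin 72 → ZMod 2)) (a : Fin 14 → ZMod 2) :
    a ∈ AA C ↔ ∃ t : ZMod 2, r5 a + t • ee ∈ C := Iff.rfl

lemma AA_cases {C : Submodule (ZMod 2) (Fin 72 → ZMod 2)} {a : Fin 14 → ZMod 2}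
    (h : a ∈ AA C) : r5 a ∈ C ∨ r5 a + ee ∈ C := by
  obtain ⟨t, ht⟩ := h
  rcases zmod2_cases t with rfl | rfl
  · left; simpa using ht
  · right; simpa using ht

lemma AA_selfDual (C : Submodule (ZMod 2) (Fin 72 → ZMod 2))
    (hsd : IsSelfDual C)
    (hg : (fun c => c ∘ ⇑g5) '' (C : Set (Fin 72 → ZMod 2)) = C) : IsSelfDual (AA C) := by
  have hC : ∀ v, v ∈ C ↔ ∀ c ∈ C, inner2 v c = 0 := fun v => by
    have := Set.ext_iff.mp hsd v
    exact this
  apply Set.Subset.antisymm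
  · rintro a ⟨s, hs⟩ b ⟨t, ht⟩
    have h := (hC _).1 hs _ ht
    rw [inner2_add_left, inner_smul_left', inner_r5, bs_r5, inner_ee] at h
    simp only [Pi.add_apply, Pi.smul_apply, r5_70, r5_71, ee_70, ee_71] at h
    rw [CharTwo.add_self_eq_zero] at h
    simpa using h
  · intro v hv
    have hS : ∀ c ∈ C, inner2 ee c = 0 → inner2 (r5 v) c = 0 := by
      intro c hc h
      rw [inner_ee] at h
      rw [inner_r5]
      exact hv _ ⟨c 70, symm_mem C hg c hc (CharTwo.add_eq_zero.mp h)⟩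
    by_cases hall : ∀ c ∈ C, inner2 ee c = 0
    · refine ⟨0, ?_⟩
      rw [hC]
      intro c hc
      simpa using hS c hc (hall c hc)
    · push Not at hall
      obtain ⟨d, hd, hne⟩ := hall
      have hd1 : inner2 ee d = 1 := (zmod2_cases _).resolve_left hne
      refine ⟨inner2 (r5 v) d, ?_⟩
      rw [hC]
      intro c hc
      rw [inner2_add_left, inner_smul_left']
      rcases zmod2_cases (inner2 ee c) with h | h
      · rw [h, hS c hc h]; simp
      · have := hS (c + d) (C.add_mem hc hd) (by rw [inner2_add_right, h, hd1]; decide)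
        rw [inner2_add_right] at this
        rw [h]; simpa using this

lemma card_sq (A : Submodule (ZMod 2) (Fin 14 → ZMod 2)) (hA : IsSelfDual A) :
    Nat.card A = 2 ^ 7 := by
  let B : LinearMap.BilinForm (ZMod 2) (Fin 14 → ZMod 2) :=
    Matrix.toBilin' (1 : Matrix (Fin 14) (Fin 14) (ZMod 2))
  have hB : ∀ v w, B v w = inner2 v w := by
    intro v w
    simp [B, Matrix.toBilin'_apply', inner2, dotProduct]
  have hnd : B.Nondegenerate := by
    exact LinearMap.BilinForm.nondegenerate_toBilin'_of_det_ne_zero' _ (by simp)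
  have hcomm : ∀ v w : Fin 14 → ZMod 2, inner2 v w = inner2 w v := fun v w => by
    simp [inner2, mul_comm]
  have hrefl : B.IsRefl := by
    intro v w h
    rw [hB] at h ⊢
    rw [hcomm]; exact h
  have horth : B.orthogonal A = A := by
    ext v
    rw [LinearMap.BilinForm.mem_orthogonal_iff]
    have := Set.ext_iff.mp hA v
    rw [SetLike.mem_coe] at this
    rw [this]
    refine forall₂_congr fun c hc => ?_
    rw [hB, hcomm]
  have := LinearMap.BilinForm.finrank_orthogonal hnd A
  rw [horth] at this
  have hle := Submodule.finrank_le A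
  rw [Module.finrank_fin_fun] at this hle
  have h7 : Module.finrank (ZMod 2) A = 7 := by omega
  rw [Module.natCard_eq_pow_finrank (K := ZMod 2), h7]
  simp

lemma plotkin (D : Submodule (ZMod 2) (Fin 14 → ZMod 2)) (hD : 9 ≤ Nat.card D)
    (h : ∀ a ∈ D, a ≠ 0 → 8 ≤ wt a) : False := by
  classical
  let S : Finset (Fin 14 → ZMod 2) := Finset.univ.filter (· ∈ D)
  have hS : ∀ a, a ∈ S ↔ a ∈ D := by simp [S]
  have hcard : Nat.card D = S.card := by
    rw [Nat.card_eq_fintype_card, Fintype.card_subtype]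
  have h1 : 8 * (S.card - 1) ≤ ∑ a ∈ S, wt a := by
    have h0 : (0 : Fin 14 → ZMod 2) ∈ S := (hS _).2 D.zero_mem
    rw [← Finset.card_erase_of_mem h0]
    calc 8 * (S.erase 0).card = ∑ a ∈ S.erase 0, 8 := by simp [mul_comm]
      _ ≤ ∑ a ∈ S.erase 0, wt a := Finset.sum_le_sum fun a ha => by
          rw [Finset.mem_erase, hS] at ha
          exact h a ha.2 ha.1
      _ ≤ _ := Finset.sum_le_sum_of_subset (Finset.erase_subset _ _)
  have h2 : ∀ i, 2 * (S.filter fun a => a i ≠ 0).card ≤ S.card := by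
    intro i
    by_cases hi : ∃ d ∈ S, d i ≠ 0
    · obtain ⟨d, hd, hdi⟩ := hi
      have hle : (S.filter fun a => a i ≠ 0).card ≤ (S.filter fun a => ¬ a i ≠ 0).card := by
        apply Finset.card_le_card_of_injOn (fun a => a + d)
        · intro a ha
          simp only [Finset.coe_filter, Set.mem_ofPred_eq, hS] at ha ⊢
          refine ⟨D.add_mem ha.1 ((hS _).1 hd), ?_⟩
          have e1 := (zmod2_cases _).resolve_left ha.2
          have e2 := (zmod2_cases _).resolve_left hdi
          rw [Pi.add_apply, e1, e2]; decide
        · intro a _ b _ hab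
          exact add_right_cancel hab
      have := Finset.card_filter_add_card_filter_not (s := S) (fun a => a i ≠ 0)
      omega
    · push Not at hi
      rw [Finset.filter_false_of_mem (by simpa using hi)]
      simp
  have h3 : ∑ a ∈ S, wt a = ∑ i, (S.filter fun a => a i ≠ 0).card := by
    simp only [wt_eq, Finset.card_filter]
    exact Finset.sum_comm
  have h4 : 2 * ∑ a ∈ S, wt a ≤ 14 * S.card := by
    rw [h3, Finset.mul_sum]
    calc _ ≤ ∑ _i : Fin 14, S.card := Finset.sum_le_sum fun i _ => h2 i
      _ = _ := by simp
  omega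

/-- For an extremal self-dual doubly-even `[72,36,16]` code invariant under the
permutation `g5` of order 5 (fourteen 5-cycles and two fixed points), the
shortened fixed code `D0 = {a ∈ F2^14 : r5 a ∈ C}` is permutation-equivalent to
the maximal doubly-even subcode of a self-dual binary code of length 14 with
minimum nonzero weight 4. -/
theorem fixed_code_of_order_five (C : Submodule (ZMod 2) (Fin 72 → ZMod 2))
    (hsd : IsSelfDual C)
    (hde : IsDoublyEven C)
    (hmin : ∀ c ∈ C, c ≠ 0 → 16 ≤ wt c)
    (hex : ∃ c ∈ C, wt c = 16)
    (hg : (fun c => c ∘ ⇑g5) '' (C : Set (Fin 72 → ZMod 2)) = C) :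
    ∃ (π : Equiv.Perm (Fin 14)) (A : Submodule (ZMod 2) (Fin 14 → ZMod 2)),
      IsSelfDual A ∧
      (∀ a ∈ A, a ≠ 0 → 4 ≤ wt a) ∧ (∃ a ∈ A, wt a = 4) ∧
      (fun a => a ∘ ⇑π) '' (C.comap r5 : Set (Fin 14 → ZMod 2))
        = {a : Fin 14 → ZMod 2 | a ∈ A ∧ 4 ∣ wt a} := by
  have hA := AA_selfDual C hsd hg
  have hr0 : ∀ a, r5 a ∈ C → 4 ∣ wt a := fun a h => by
    have := hde _ h
    rw [wt_r5] at this
    omega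
  have hr1 : ∀ a, r5 a + ee ∈ C → 6 ≤ wt a ∧ wt a % 4 = 2 := fun a h => by
    have h1 := hde _ h
    have h2 := hmin _ h (fun h0 => by
      have := congrFun h0 70
      rw [Pi.add_apply, r5_70, ee_70] at this
      simp at this)
    rw [wt_r5e] at h1 h2
    omega
  have hwt0 : ∀ a : Fin 14 → ZMod 2, a ≠ 0 → 0 < wt a := fun a h => by
    obtain ⟨i, hi⟩ := Function.ne_iff.mp h
    exact Finset.card_pos.mpr ⟨i, by simpa using hi⟩
  have hmem : ∀ a, r5 a ∈ C → a ∈ AA C := fun a h => ⟨0, by simpa using h⟩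
  refine ⟨1, AA C, hA, ?_, ?_, ?_⟩
  · intro a ha hne
    rcases AA_cases ha with h | h
    · have := hr0 a h
      have := hwt0 a hne
      omega
    · have := hr1 a h
      omega
  · by_contra hno
    push Not at hno
    refine plotkin (C.comap r5) ?_ ?_
    · have hc := card_sq _ hA
      suffices hh : Nat.card (AA C) ≤ 2 * Nat.card (C.comap r5) by omega
      by_cases hex2 : ∃ d, r5 d + ee ∈ C
      · obtain ⟨d, hd⟩ := hex2
        have hsub : (AA C : Set (Fin 14 → ZMod 2)) ⊆
            (C.comap r5 : Set (Fin 14 → ZMod 2)) ∪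
              (fun a => a + d) '' (C.comap r5 : Set (Fin 14 → ZMod 2)) := by
          intro a ha
          rcases AA_cases ha with h | h
          · exact Or.inl h
          · refine Or.inr ⟨a + d, ?_, ?_⟩
            · have := C.add_mem h hd
              change r5 (a + d) ∈ C
              convert this using 1
              rw [map_add, add_add_add_comm, CharTwo.add_self_eq_zero ee, add_zero]
            · change a + d + d = a
              rw [add_assoc, CharTwo.add_self_eq_zero d, add_zero]
        have e1 := Set.ncard_le_ncard hsub (Set.toFinite _)
        have e2 := Set.ncard_union_le (C.comap r5 : Set (Fin 14 → ZMod 2))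
          ((fun a => a + d) '' (C.comap r5 : Set (Fin 14 → ZMod 2)))
        have e3 := Set.ncard_image_le (f := fun a => a + d)
          (Set.toFinite (C.comap r5 : Set (Fin 14 → ZMod 2)))
        change (AA C : Set (Fin 14 → ZMod 2)).ncard
          ≤ 2 * (C.comap r5 : Set (Fin 14 → ZMod 2)).ncard
        omega
      · have hsub : (AA C : Set (Fin 14 → ZMod 2)) ⊆
            (C.comap r5 : Set (Fin 14 → ZMod 2)) := by
          intro a ha
          rcases AA_cases ha with h | h
          · exact h
          · exact absurd ⟨a, h⟩ hex2
        have e1 := Set.ncard_le_ncard hsub (Set.toFinite _)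
        change (AA C : Set (Fin 14 → ZMod 2)).ncard
          ≤ 2 * (C.comap r5 : Set (Fin 14 → ZMod 2)).ncard
        omega
    · intro a ha hne
      have ha' : r5 a ∈ C := ha
      have h1 := hr0 a ha'
      have h2 := hwt0 a hne
      have h3 := hno a (hmem a ha')
      omega
  · ext a
    simp only [Equiv.Perm.coe_one, Function.comp_id, Set.image_id', SetLike.mem_coe,
      Submodule.mem_comap, Set.mem_ofPred_eq]
    constructor
    · exact fun h => ⟨hmem a h, hr0 a h⟩
    · rintro ⟨ha, h4⟩
      rcases AA_cases ha with h | h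
      · exact h
      · have := hr1 a h
        omega
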